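/- Let k be a field of characteristic p > 2. In the polynomial ring k[X,Y], composing the coaction of G_{a(r)} (X ↦ t⊗Y + 1⊗X, Y ↦ 1⊗Y, t^{p^r} = 0) with the action of (Z/p)^s (g_i(X) = X - μ_iY, μ_i 𝔽_p-linearly independent), the simultaneous invariants are k[X,Y]^{G_{a(r)} × (Z/p)^s} = k[φ^{p^r}, Y], where φ = ∏_{(a₁,…,a_s)∈𝔽_p^s}(X + (∑ a_iμ_i)Y). -/

import Mathlib

open MvPolynomial
open scoped TensorProduct

/-- The coordinate algebra `k[G_{a(r)}] = k[t]/(t^{p^r})`. -/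
noncomputable abbrev FrobKer (k : Type) [Field k] (p r : ℕ) : Type :=
  Polynomial k ⧸ Ideal.span {(Polynomial.X : Polynomial k) ^ p ^ r}

/-- The coaction `k[X,Y] → k[t]/(t^{p^r}) ⊗ k[X,Y]` determined by `Y ↦ 1⊗Y` and
`X ↦ t⊗Y + 1⊗X` (we write `X = X 0`, `Y = X 1`). -/
noncomputable def coact (k : Type) [Field k] (p r : ℕ) :
    MvPolynomial (Fin 2) k →ₐ[k] (FrobKer k p r ⊗[k] MvPolynomial (Fin 2) k) :=
  aeval (fun j : Fin 2 => if j = 0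
    then (Ideal.Quotient.mk (Ideal.span {(Polynomial.X : Polynomial k) ^ p ^ r})
          (Polynomial.X : Polynomial k)) ⊗ₜ[k] (X 1 : MvPolynomial (Fin 2) k)
        + 1 ⊗ₜ[k] (X 0 : MvPolynomial (Fin 2) k)
    else 1 ⊗ₜ[k] (X 1 : MvPolynomial (Fin 2) k))

/-- The `k`-algebra automorphism of `k[X,Y]` determined by `X ↦ X - cY`, `Y ↦ Y`. -/
noncomputable def substAct (k : Type) [Field k] (c : k) :
    MvPolynomial (Fin 2) k →ₐ[k] MvPolynomial (Fin 2) k :=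
  aeval (fun j : Fin 2 => if j = 0 then X 0 - C c * X 1 else X 1)


namespace Polynomial

/-- The Hasse derivatives of order `1 ≤ j < p ^ r` detect the polynomials in `X ^ p ^ r`. -/
theorem expand_contract_of_hasseDeriv_eq_zero {R : Type*} [CommRing R] [IsDomain R] (p : ℕ)
    [Fact p.Prime] [CharP R p] (r : ℕ) {f : R[X]}
    (hf : ∀ j, 0 < j → j < p ^ r → hasseDeriv j f = 0) :
    expand R (p ^ r) (contract (p ^ r) f) = f := by
  have hq : 0 < p ^ r := pow_pos (Fact.out : p.Prime).pos r
  ext n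
  rw [coeff_expand hq]
  split_ifs with h
  · rw [coeff_contract hq.ne', Nat.div_mul_cancel h]
  · have hj : 0 < n % p ^ r := Nat.pos_of_ne_zero fun h0 => h (Nat.dvd_of_mod_eq_zero h0)
    have key := congrArg (fun g => g.coeff (n - n % p ^ r)) (hf _ hj (Nat.mod_lt _ hq))
    have hchoose : ((n.choose (n % p ^ r) : ℕ) : R) = 1 := by
      have hmod := Choose.choose_modEq_choose_mul_prod_range_choose (p := p) (n := n)
        (k := n % p ^ r) r
      rw [Nat.div_eq_of_lt (Nat.mod_lt _ hq), Nat.choose_zero_right,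
        Finset.prod_eq_one fun i hi => ?_] at hmod
      · simpa using (CharP.intCast_eq_intCast R p).2 hmod
      · have hi : i < r := Finset.mem_range.1 hi
        rw [← Nat.add_sub_cancel' hi.le, pow_add, Nat.mod_mul_right_div_self,
          Nat.mod_mod_of_dvd _ (dvd_pow_self p (Nat.sub_pos_of_lt hi).ne'), Nat.choose_self]
    simp only [hasseDeriv_coeff, Nat.sub_add_cancel (Nat.mod_le _ _), hchoose, one_mul,
      coeff_zero] at key
    exact key.symm

/-- A polynomial `f` with `f(X + TY) ≡ f(X)` modulo `T ^ n` has vanishing Hasse derivatives of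
order `0 < j < n`, provided `Y` is a nonzero constant. -/
theorem hasseDeriv_eq_zero_of_dvd {R : Type*} [CommRing R] [IsDomain R] {y : R} (hy : y ≠ 0)
    {n : ℕ} {f : R[X]}
    (hf : (X : R[X][X]) ^ n ∣ aeval (C (C y) * X + C X) f - C f)
    {j : ℕ} (hj : 0 < j) (hjn : j < n) : hasseDeriv j f = 0 := by
  have h := X_pow_dvd_iff.1 hf j hjn
  have hcomp : aeval (C (C y) * X + C X) f
      = (taylor X (f.map (C : R →+* R[X]))).comp (C (C y) * X) := by
    rw [taylor_apply, comp_assoc]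
    simp [comp, eval₂_map, aeval_def, IsScalarTower.algebraMap_eq R R[X] R[X][X]]
  have hmap : hasseDeriv j (f.map (C : R →+* R[X])) = (hasseDeriv j f).map C := by
    ext1 i
    simp [hasseDeriv_coeff]
  rw [hcomp, coeff_sub, comp_C_mul_X_coeff, taylor_coeff, coeff_C_of_ne_zero hj.ne', sub_zero,
    hmap, eval_map, eval₂_C_X] at h
  exact (mul_eq_zero.1 h).resolve_right (pow_ne_zero _ (C_ne_zero.2 hy))

/-- Over a domain, the polynomials invariant under the translations by a finite group `m(ι)` are
the polynomials in the orbit product of `X`. -/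
theorem exists_comp_prod_eq_of_forall_taylor_eq {R ι : Type*} [CommRing R] [IsDomain R]
    [AddCommGroup ι] [Fintype ι] (m : ι →+ R) (hm : Function.Injective m) (f : R[X])
    (hf : ∀ a, taylor (m a) f = f) :
    ∃ g : R[X], g.comp (∏ a, (X + C (m a))) = f := by
  set Φ : R[X] := ∏ a, (X + C (m a)) with hΦ
  have hmonic : Φ.Monic := monic_prod_of_monic _ _ fun a _ => monic_X_add_C _
  have hdeg : 0 < Φ.natDegree := by
    rw [hΦ, natDegree_prod_of_monic _ _ fun a _ => monic_X_add_C _]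
    simp [Fintype.card_pos]
  have htaylor : ∀ a, taylor (m a) Φ = Φ := fun a => by
    rw [hΦ, taylor_apply, prod_comp]
    refine Fintype.prod_equiv (Equiv.addLeft a) _ _ fun b => ?_
    simp [add_assoc]
  have hdvd : ∀ f : R[X], (∀ a, f.eval (m a) = 0) → Φ ∣ f := fun f hf => by
    obtain rfl | h0 := eq_or_ne f 0
    · exact dvd_zero _
    have hprod : Φ = ((Finset.univ.val.map fun a => -m a).map fun c => X - C c).prod := by
      simp only [hΦ, Multiset.map_map, Function.comp_def, C_neg, sub_neg_eq_add]
      rfl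
    rw [hprod, Multiset.prod_X_sub_C_dvd_iff_le_roots h0, Multiset.le_iff_subset
      (Multiset.Nodup.map (fun a b h => hm (neg_injective h)) Finset.univ.nodup)]
    intro c hc
    obtain ⟨a, -, rfl⟩ := Multiset.mem_map.1 hc
    rw [mem_roots h0, IsRoot.def, ← map_neg, hf]
  induction hn : f.natDegree using Nat.strong_induction_on generalizing f with
  | _ n ih =>
    obtain ⟨g, hg⟩ := hdvd (f - C (f.eval 0)) fun a => by
      have := congrArg (eval 0) (hf a)
      rw [taylor_eval, zero_add] at this
      simp [this]
    obtain rfl | h0 := eq_or_ne g 0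
    · exact ⟨C (f.eval 0), by rw [C_comp, ← sub_eq_zero, ← neg_sub, hg]; simp⟩
    have hginv : ∀ a, taylor (m a) g = g := fun a => by
      have := congrArg (taylor (m a)) hg
      rw [map_sub, hf, taylor_C, taylor_mul, htaylor, hg] at this
      exact (mul_left_cancel₀ hmonic.ne_zero this).symm
    have hlt : g.natDegree < n := by
      have := congrArg natDegree hg
      rw [natDegree_sub_C, hmonic.natDegree_mul' h0, hn] at this
      lia
    obtain ⟨h, hh⟩ := ih _ hlt g hginv rfl
    exact ⟨C (f.eval 0) + X * h, by rw [add_comp, C_comp, mul_comp, X_comp, hh, ← hg]; ring⟩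

/-- The translations fixing a polynomial form a group. -/
def taylorStabilizer {R : Type*} [CommRing R] (f : R[X]) : AddSubgroup R where
  carrier := {c | taylor c f = f}
  zero_mem' := taylor_zero f
  add_mem' {a b} ha hb := by
    simp only [Set.mem_ofPred_eq] at ha hb ⊢
    rw [← taylor_taylor, hb, ha]
  neg_mem' {a} ha := by
    simp only [Set.mem_ofPred_eq] at ha ⊢
    conv_lhs => rw [← ha, taylor_taylor, neg_add_cancel, taylor_zero]

end Polynomial


theorem add_pow_char_pow_of_algebra (k : Type*) {A : Type*} [Field k] [CommSemiring A]
    [Algebra k A] (p n : ℕ) [Fact p.Prime] [CharP k p] (x y : A) :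
    (x + y) ^ p ^ n = x ^ p ^ n + y ^ p ^ n := by
  obtain _ | _ := subsingleton_or_nontrivial A
  · exact Subsingleton.elim _ _
  · have : CharP A p := charP_of_injective_algebraMap (algebraMap k A).injective p
    exact add_pow_char_pow x y p n

section Invariants

variable {k : Type} [Field k]

theorem finSuccEquiv_one_apply (f : MvPolynomial (Fin 2) k) :
    finSuccEquiv k 1 f = aeval ![Polynomial.X, Polynomial.C (X 0)] f := by
  rw [finSuccEquiv_apply, aeval_def, coe_eval₂Hom]
  congr 1
  ext i : 1
  fin_cases i <;> rfl

theorem substAct_apply (c : k) (f : MvPolynomial (Fin 2) k) :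
    substAct k c f = aeval ![X 0 - C c * X 1, X 1] f := by
  rw [substAct]
  congr 2
  ext1 i
  fin_cases i <;> rfl

theorem coact_apply (p r : ℕ) (f : MvPolynomial (Fin 2) k) :
    coact k p r f = aeval ![(Ideal.Quotient.mk _ Polynomial.X) ⊗ₜ[k] X 1 + 1 ⊗ₜ[k] X 0,
      1 ⊗ₜ[k] X 1] f := by
  rw [coact]
  congr 2
  ext1 i
  fin_cases i <;> rfl

theorem map_aeval_pair {A B : Type*} [CommSemiring A] [CommSemiring B] [Algebra k A] [Algebra k B]
    (ψ : A →ₐ[k] B) (x y : A) (f : MvPolynomial (Fin 2) k) :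
    ψ (aeval ![x, y] f) = aeval ![ψ x, ψ y] f := by
  rw [← AlgHom.comp_apply, comp_aeval]
  congr 2
  ext1 i
  fin_cases i <;> rfl

theorem finSuccEquiv_substAct (c : k) (f : MvPolynomial (Fin 2) k) :
    finSuccEquiv k 1 (substAct k c f) =
      Polynomial.taylor (-(C c * X 0)) (finSuccEquiv k 1 f) := by
  have hC : finSuccEquiv k 1 (C c) = Polynomial.C (C c) := by simp [finSuccEquiv_apply]
  have h1 : finSuccEquiv k 1 (X 1) = Polynomial.C (X 0) := finSuccEquiv_X_succ (j := 0)
  have hl : finSuccEquiv k 1 (aeval ![X 0 - C c * X 1, X 1] f) =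
      aeval ![finSuccEquiv k 1 (X 0 - C c * X 1), finSuccEquiv k 1 (X 1)] f :=
    map_aeval_pair (finSuccEquiv k 1).toAlgHom (X 0 - C c * X 1) (X 1) f
  have hr := map_aeval_pair ((Polynomial.taylorAlgHom (-(C c * X 0))).restrictScalars k)
    Polynomial.X (Polynomial.C (X 0 : MvPolynomial (Fin 1) k)) f
  simp only [AlgHom.restrictScalars_apply,
    Polynomial.taylorAlgHom_apply, map_sub, map_mul, hC, h1, finSuccEquiv_X_zero,
    Polynomial.taylor_X, Polynomial.taylor_C, map_neg, ← sub_eq_add_neg] at hl hr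
  rw [substAct_apply, hl, finSuccEquiv_one_apply f, hr]

theorem aeval_eq_of_aeval_tmul_eq {F B : Type*} [CommRing F] [Algebra k F] [CommRing B]
    [Algebra k B] {t : F} {f : MvPolynomial (Fin 2) k}
    (hf : aeval ![t ⊗ₜ[k] (X 1 : MvPolynomial (Fin 2) k) + 1 ⊗ₜ[k] X 0, 1 ⊗ₜ[k] X 1] f =
      1 ⊗ₜ[k] f) (T : F →ₐ[k] B) (x y : B) :
    aeval ![y * T t + x, y] f = aeval ![x, y] f := by
  let ψ : F ⊗[k] MvPolynomial (Fin 2) k →ₐ[k] B :=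
    Algebra.TensorProduct.lift T (aeval ![x, y]) fun _ _ => Commute.all _ _
  have h := congrArg ψ hf
  rw [map_aeval_pair] at h
  simpa [ψ, mul_comm y] using h

/-- An invariant of the coaction is unchanged by `X ↦ X + tY` modulo `t ^ p ^ r`. -/
theorem pow_dvd_aeval_sub_of_coact_eq {p r : ℕ} {f : MvPolynomial (Fin 2) k}
    (hf : coact k p r f = 1 ⊗ₜ[k] f) {A : Type*} [CommRing A] [Algebra k A] (t x y : A) :
    t ^ p ^ r ∣ aeval ![y * t + x, y] f - aeval ![x, y] f := by
  rw [← Ideal.mem_span_singleton, ← Ideal.Quotient.eq]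
  set I := Ideal.span {t ^ p ^ r}
  let π := Ideal.Quotient.mkₐ k I
  let T : FrobKer k p r →ₐ[k] A ⧸ I :=
    Ideal.Quotient.liftₐ _ (Polynomial.aeval (π t)) fun a ha => by
      obtain ⟨b, rfl⟩ := Ideal.mem_span_singleton.1 ha
      have ht : π (t ^ p ^ r) = 0 :=
        Ideal.Quotient.eq_zero_iff_mem.2 (Ideal.mem_span_singleton_self _)
      rw [map_mul, map_pow, Polynomial.aeval_X, ← map_pow, ht, zero_mul]
  have hT : T (Ideal.Quotient.mk _ Polynomial.X) = π t := Polynomial.aeval_X _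
  have h := aeval_eq_of_aeval_tmul_eq ((coact_apply p r f).symm.trans hf) T (π x) (π y)
  change π _ = π _
  rw [map_aeval_pair, map_aeval_pair, map_add, map_mul, ← hT]
  exact h

theorem hasseDeriv_aeval_of_coact_eq {p r : ℕ} {f : MvPolynomial (Fin 2) k}
    (hf : coact k p r f = 1 ⊗ₜ[k] f) {R : Type*} [CommRing R] [IsDomain R] [Algebra k R] {y : R}
    (hy : y ≠ 0) {j : ℕ} (hj : 0 < j) (hjq : j < p ^ r) :
    Polynomial.hasseDeriv j (aeval ![Polynomial.X, Polynomial.C y] f) = 0 := by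
  refine Polynomial.hasseDeriv_eq_zero_of_dvd hy (n := p ^ r) ?_ hj hjq
  have h := pow_dvd_aeval_sub_of_coact_eq hf Polynomial.X (Polynomial.C Polynomial.X)
    (Polynomial.C (Polynomial.C y))
  have hl := map_aeval_pair ((Polynomial.aeval (Polynomial.C (Polynomial.C y) *
    Polynomial.X + Polynomial.C Polynomial.X)).restrictScalars k) Polynomial.X (Polynomial.C y) f
  have hr := map_aeval_pair (Polynomial.CAlgHom (R := k) (A := Polynomial R)) Polynomial.X
    (Polynomial.C y) f
  simp only [AlgHom.restrictScalars_apply, Polynomial.aeval_X, Polynomial.aeval_C,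
    Polynomial.CAlgHom_apply, Polynomial.algebraMap_apply] at hl hr
  rw [hl, hr]
  exact h

theorem coact_X_one (p r : ℕ) : coact k p r (X 1) = 1 ⊗ₜ[k] X 1 := by
  simp [coact]

theorem aeval_tmul_X_zero_add_pow {F : Type*} [CommRing F] [Algebra k F] {p r : ℕ}
    [Fact p.Prime] [CharP k p] {t : F} (ht : t ^ p ^ r = 0) (c : k) :
    aeval ![t ⊗ₜ[k] (X 1 : MvPolynomial (Fin 2) k) + 1 ⊗ₜ[k] X 0, 1 ⊗ₜ[k] X 1]
      ((X 0 + C c * X 1 : MvPolynomial (Fin 2) k) ^ p ^ r) =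
      1 ⊗ₜ[k] ((X 0 + C c * X 1) ^ p ^ r) := by
  have hc : (1 : F) ⊗ₜ[k] (C c * X 1 : MvPolynomial (Fin 2) k) = c • (1 : F) ⊗ₜ[k] X 1 := by
    rw [← TensorProduct.tmul_smul, smul_eq_C_mul]
  have h : aeval ![t ⊗ₜ[k] (X 1 : MvPolynomial (Fin 2) k) + 1 ⊗ₜ[k] X 0, 1 ⊗ₜ[k] X 1]
      (X 0 + C c * X 1 : MvPolynomial (Fin 2) k) = t ⊗ₜ[k] X 1 + 1 ⊗ₜ[k] (X 0 + C c * X 1) := by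
    rw [TensorProduct.tmul_add, hc, ← smul_eq_C_mul, map_add, map_smul]
    simp [add_assoc]
  rw [map_pow, h, add_pow_char_pow_of_algebra k, Algebra.TensorProduct.tmul_pow, ht,
    TensorProduct.zero_tmul, zero_add, Algebra.TensorProduct.tmul_pow, one_pow]

theorem coact_X_zero_add_pow (p r : ℕ) [Fact p.Prime] [CharP k p] (c : k) :
    coact k p r ((X 0 + C c * X 1) ^ p ^ r) = 1 ⊗ₜ[k] ((X 0 + C c * X 1) ^ p ^ r) := by
  refine (coact_apply _ _ _).trans (aeval_tmul_X_zero_add_pow ?_ c)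
  rw [← map_pow]
  exact Ideal.Quotient.eq_zero_iff_mem.2 (Ideal.mem_span_singleton_self _)

theorem expand_taylor_pow {R : Type*} [CommRing R] (p r : ℕ) [Fact p.Prime] [CharP R p] (c : R)
    (f : Polynomial R) :
    Polynomial.expand R (p ^ r) (Polynomial.taylor (c ^ p ^ r) f) =
      Polynomial.taylor c (Polynomial.expand R (p ^ r) f) := by
  simp only [Polynomial.expand_eq_comp_X_pow, Polynomial.taylor_apply, Polynomial.comp_assoc,
    Polynomial.add_comp, Polynomial.X_comp, Polynomial.C_comp, Polynomial.pow_comp,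
    Polynomial.C_pow, add_pow_char_pow]

/-- The homomorphism `a ↦ ∑ aᵢ μᵢ`. -/
def zmodCombination (p : ℕ) [Fact p.Prime] {R : Type*} [CommRing R] [CharP R p] {s : ℕ}
    (μ : Fin s → R) : (Fin s → ZMod p) →+ R where
  toFun a := ∑ i, ZMod.castHom (dvd_refl p) R (a i) * μ i
  map_zero' := by simp
  map_add' a b := by simp only [Pi.add_apply, map_add, add_mul, Finset.sum_add_distrib]

theorem zmodCombination_apply (p : ℕ) [Fact p.Prime] {R : Type*} [CommRing R] [CharP R p] {s : ℕ}
    (μ : Fin s → R) (a : Fin s → ZMod p) :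
    zmodCombination p μ a = ∑ i, ZMod.castHom (dvd_refl p) R (a i) * μ i :=
  rfl

theorem zmodCombination_mem (p : ℕ) [Fact p.Prime] {R : Type*} [CommRing R] [CharP R p] {s : ℕ}
    {μ : Fin s → R} {H : AddSubgroup R} (hμ : ∀ i, μ i ∈ H) (a : Fin s → ZMod p) :
    zmodCombination p μ a ∈ H := by
  rw [zmodCombination_apply]
  refine AddSubgroup.sum_mem H fun i _ => ?_
  have h : ZMod.castHom (dvd_refl p) R (a i) * μ i = (a i).val • μ i := by
    rw [nsmul_eq_mul, ← map_natCast (ZMod.castHom (dvd_refl p) R), ZMod.natCast_zmod_val]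
  exact h ▸ nsmul_mem (hμ i) _

theorem zmodCombination_single (p : ℕ) [Fact p.Prime] {R : Type*} [CommRing R] [CharP R p] {s : ℕ}
    (μ : Fin s → R) (i : Fin s) : zmodCombination p μ (Pi.single i 1) = μ i := by
  rw [zmodCombination_apply, Finset.sum_eq_single i (fun j _ hj => by simp [hj]) (by simp)]
  simp

theorem substAct_X_zero_add (c d : k) :
    substAct k c (X 0 + C d * X 1) = X 0 + C (d - c) * X 1 := by
  rw [← smul_eq_C_mul, map_add, map_smul, smul_eq_C_mul]
  simp only [substAct, aeval_X, if_true, one_ne_zero, if_false, C_sub]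
  ring

theorem finSuccEquiv_X_zero_add (c : k) :
    finSuccEquiv k 1 (X 0 + C c * X 1) = Polynomial.X + Polynomial.C (C c * X 0) := by
  have hC : finSuccEquiv k 1 (C c) = Polynomial.C (C c) := by simp [finSuccEquiv_apply]
  have h1 : finSuccEquiv k 1 (X 1) = Polynomial.C (X 0) := finSuccEquiv_X_succ (j := 0)
  rw [map_add, map_mul, hC, h1, finSuccEquiv_X_zero, map_mul]

theorem finSuccEquiv_symm_C_mem {B : Subalgebra k (MvPolynomial (Fin 2) k)} (hB : X 1 ∈ B)
    (a : MvPolynomial (Fin 1) k) : (finSuccEquiv k 1).symm (Polynomial.C a) ∈ B := by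
  induction a using MvPolynomial.induction_on with
  | C c =>
    have hC : finSuccEquiv k 1 (C c) = Polynomial.C (C c) := by simp [finSuccEquiv_apply]
    rw [← hC, AlgEquiv.symm_apply_apply]
    exact B.algebraMap_mem c
  | add a b ha hb => simpa only [map_add] using add_mem ha hb
  | mul_X a i ha =>
    have h1 : finSuccEquiv k 1 (X 1) = Polynomial.C (X i) := by
      rw [Subsingleton.elim i 0]
      exact finSuccEquiv_X_succ (j := 0)
    rw [map_mul, map_mul, ← h1, AlgEquiv.symm_apply_apply]
    exact mul_mem ha hB

theorem finSuccEquiv_symm_comp_mem {B : Subalgebra k (MvPolynomial (Fin 2) k)} (hB : X 1 ∈ B)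
    {φ : MvPolynomial (Fin 2) k} (hφ : φ ∈ B) (g : Polynomial (MvPolynomial (Fin 1) k)) :
    (finSuccEquiv k 1).symm (g.comp (finSuccEquiv k 1 φ)) ∈ B := by
  induction g using Polynomial.induction_on' with
  | add f g hf hg => simpa only [Polynomial.add_comp, map_add] using add_mem hf hg
  | monomial n a =>
    rw [Polynomial.monomial_comp, map_mul, map_pow, AlgEquiv.symm_apply_apply]
    exact mul_mem (finSuccEquiv_symm_C_mem hB a) (pow_mem hφ n)

end Invariants

/-- Let `k` be a field of characteristic `p > 2`.  Combining the coaction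
of `G_{a(r)}` on `k[X,Y]` (`X ↦ t⊗Y + 1⊗X`, `Y ↦ 1⊗Y`, `t^{p^r} = 0`) with the commuting
action of `(ℤ/p)^s` (`gᵢ(X) = X - μᵢY`, the `μᵢ` being `𝔽_p`-linearly independent), the
simultaneous invariants are `k[X,Y]^{G_{a(r)} × (ℤ/p)^s} = k[φ^{p^r}, Y]`, where
`φ = ∏_{(a₁,…,a_s) ∈ 𝔽_p^s} (X + (∑ aᵢμᵢ)Y)`. -/
theorem invariants_product_group_scheme (p : ℕ) [Fact p.Prime] (hp : Odd p)
    (k : Type) [Field k] [CharP k p] (r s : ℕ) (μ : Fin s → k)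
    (hμ : ∀ c : Fin s → ZMod p,
      ∑ i, ZMod.castHom (dvd_refl p) k (c i) * μ i = 0 → c = 0) :
    (AlgHom.equalizer (coact k p r)
        (Algebra.TensorProduct.includeRight :
          MvPolynomial (Fin 2) k →ₐ[k] FrobKer k p r ⊗[k] MvPolynomial (Fin 2) k)) ⊓
      (⨅ i : Fin s, AlgHom.equalizer (substAct k (μ i))
        (AlgHom.id k (MvPolynomial (Fin 2) k))) =
      Algebra.adjoin k
        {(∏ a : Fin s → ZMod p,
            (X 0 + C (∑ i, ZMod.castHom (dvd_refl p) k (a i) * μ i) * X 1)) ^ p ^ r,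
         (X 1 : MvPolynomial (Fin 2) k)} := by
  have hm : Function.Injective (zmodCombination p μ) :=
    (injective_iff_map_eq_zero _).2 fun a ha => hμ a ha
  simp only [← zmodCombination_apply]
  apply le_antisymm
  · rintro f ⟨hco, hsub⟩
    replace hco : coact k p r f = 1 ⊗ₜ[k] f := hco
    replace hsub : ∀ i, substAct k (μ i) f = f := fun i => (Algebra.mem_iInf.1 hsub) i
    set q := p ^ r with hq
    set F := finSuccEquiv k 1 f with hF
    have hexp : Polynomial.expand _ q (Polynomial.contract q F) = F :=
      Polynomial.expand_contract_of_hasseDeriv_eq_zero p r fun j hj hjq => by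
        rw [hF, finSuccEquiv_one_apply]
        exact hasseDeriv_aeval_of_coact_eq hco (X_ne_zero 0) hj hjq
    let Y : k →+ MvPolynomial (Fin 1) k :=
      (AddMonoidHom.mulRight (X 0)).comp (C : k →+* MvPolynomial (Fin 1) k).toAddMonoidHom
    have hY : ∀ c, Y c = C c * X 0 := fun _ => rfl
    have hYinj : Function.Injective Y := fun a b h =>
      C_injective _ _ (mul_right_cancel₀ (X_ne_zero (0 : Fin 1)) h)
    have hstab : ∀ a, Polynomial.taylor (Y (zmodCombination p μ a)) F = F :=
      zmodCombination_mem p (H := (Polynomial.taylorStabilizer F).comap Y) fun i => by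
        rw [← neg_mem_iff]
        change Polynomial.taylor (Y (-μ i)) F = F
        rw [map_neg, hY, hF, ← finSuccEquiv_substAct, hsub]
    let M : (Fin s → ZMod p) →+ MvPolynomial (Fin 1) k :=
      (iterateFrobenius (MvPolynomial (Fin 1) k) p r).toAddMonoidHom.comp
        (Y.comp (zmodCombination p μ))
    have hM : ∀ a, M a = Y (zmodCombination p μ a) ^ q := fun _ => rfl
    have hMinj : Function.Injective M :=
      (iterateFrobenius_inj (MvPolynomial (Fin 1) k) p r).comp (hYinj.comp hm)
    have hqpos : 0 < q := pow_pos (Fact.out : p.Prime).pos r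
    obtain ⟨g, hg⟩ := Polynomial.exists_comp_prod_eq_of_forall_taylor_eq M hMinj
      (Polynomial.contract q F) fun a => Polynomial.expand_injective hqpos <| by
        rw [hM, hq, expand_taylor_pow, ← hq, hexp, hstab]
    have hφ : Polynomial.expand _ q (∏ a, (Polynomial.X + Polynomial.C (M a))) =
        finSuccEquiv k 1 ((∏ a, (X 0 + C (zmodCombination p μ a) * X 1)) ^ q) := by
      rw [map_pow, map_prod, map_prod, ← Finset.prod_pow]
      refine Finset.prod_congr rfl fun a _ => ?_
      rw [finSuccEquiv_X_zero_add, hq, add_pow_char_pow, map_add, Polynomial.expand_X,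
        Polynomial.expand_C, hM, hY, Polynomial.C_pow]
    have hf : f = (finSuccEquiv k 1).symm (g.comp
        (finSuccEquiv k 1 ((∏ a, (X 0 + C (zmodCombination p μ a) * X 1)) ^ q))) := by
      rw [AlgEquiv.eq_symm_apply, ← hφ, ← hF, ← hexp, ← hg]
      simp only [Polynomial.expand_eq_comp_X_pow, Polynomial.comp_assoc]
    rw [hf]
    exact finSuccEquiv_symm_comp_mem (Algebra.subset_adjoin (by simp))
      (Algebra.subset_adjoin (by simp)) g
  · rw [Algebra.adjoin_le_iff]
    rintro f (rfl | rfl)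
    · refine ⟨?_, Algebra.mem_iInf.2 fun i => ?_⟩
      · change _ ∈ AlgHom.equalizer (coact k p r) Algebra.TensorProduct.includeRight
        rw [← Finset.prod_pow]
        exact prod_mem fun a _ => coact_X_zero_add_pow p r _
      · change substAct k (μ i) _ = _
        rw [map_pow, map_prod]
        congr 1
        refine Fintype.prod_equiv (Equiv.subRight (Pi.single i 1)) _ _ fun a => ?_
        rw [substAct_X_zero_add, Equiv.subRight_apply, map_sub (zmodCombination p μ),
          zmodCombination_single]
    · refine ⟨coact_X_one p r, Algebra.mem_iInf.2 fun i => ?_⟩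
      change substAct k (μ i) (X 1) = X 1
      simp [substAct]
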